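/- Let S_1 ⊂ S_2 ⊂ ⋯ ⊂ S_N ⊂ I be rectangles with all inclusions strict. Let x ≠ y lie in the same fiber F_t of A_{S_1,…,S_N} and put z = x − y. If z vanishes identically on S_N (and hence on all S_n), then ‖z‖_1 can be reduced by the set of basic moves belonging to M_{S_1,…,S_N}. -/

import Mathlib

open Finset

namespace Paper

abbrev Table (R C : ℕ) := Fin R × Fin C → ℤ

/-- The table with entry 1 in cell `a` and 0 elsewhere. -/
def e {R C : ℕ} (a : Fin R × Fin C) : Table R C := fun p => if p = a then 1 else 0

/-- The l1-norm of an integer table. -/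
def l1 {R C : ℕ} (z : Table R C) : ℤ := ∑ p : Fin R × Fin C, |z p|

/-- The configuration `A_{S_1,…,S_N}` : row sums, column sums and subtable sums. -/
def configMap {R C N : ℕ} (S : Fin N → Finset (Fin R × Fin C)) (z : Table R C) :
    (Fin R → ℤ) × (Fin C → ℤ) × (Fin N → ℤ) :=
  ⟨fun i => ∑ j, z (i, j), fun j => ∑ i, z (i, j), fun n => ∑ p ∈ S n, z p⟩

/-- A move for `A_{S_1,…,S_N}` : an integer table with vanishing row sums,
column sums and subtable sums. -/
def IsMove {R C N : ℕ} (S : Fin N → Finset (Fin R × Fin C)) (z : Table R C) : Prop :=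
  configMap S z = 0

/-- The fiber `F_t` of the configuration `A_{S_1,…,S_N}` : nonnegative integer tables
with prescribed row sums, column sums and subtable sums. -/
def Fiber {R C N : ℕ} (S : Fin N → Finset (Fin R × Fin C))
    (t : (Fin R → ℤ) × (Fin C → ℤ) × (Fin N → ℤ)) : Set (Table R C) :=
  {x | (∀ p, 0 ≤ x p) ∧ configMap S x = t}

/-- `B` is a Markov basis for the configuration `A_{S_1,…,S_N}`. -/
def IsMarkovBasis {R C N : ℕ} (S : Fin N → Finset (Fin R × Fin C))
    (B : Set (Table R C)) : Prop :=
  B.Finite ∧ (∀ z ∈ B, IsMove S z) ∧ (∀ z ∈ B, -z ∈ B) ∧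
    ∀ t, ∀ x ∈ Fiber S t, ∀ y ∈ Fiber S t, x ≠ y →
      ∃ U : ℕ, 0 < U ∧ ∃ zs : Fin U → Table R C,
        (∀ u, zs u ∈ B) ∧ y = x + ∑ u, zs u ∧
        ∀ u : Fin U, (x + ∑ s ∈ Finset.Iic u, zs s) ∈ Fiber S t

/-- `‖x − y‖₁` can be reduced by the set of moves `B` within the fiber `F`. -/
def CanReduce {R C : ℕ} (F : Set (Table R C)) (B : Set (Table R C))
    (x y : Table R C) : Prop :=
  ∃ τp τm : ℕ, 0 < τp + τm ∧
    ∃ (Bp : Fin τp → Table R C) (Bm : Fin τm → Table R C),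
      (∀ s, Bp s ∈ B) ∧ (∀ s, Bm s ∈ B) ∧
      (∀ u : Fin τp, (x + ∑ s ∈ Finset.Iic u, Bp s) ∈ F) ∧
      (∀ u : Fin τm, (y - ∑ s ∈ Finset.Iic u, Bm s) ∈ F) ∧
      l1 (x - y + ∑ s, Bp s + ∑ s, Bm s) < l1 (x - y)

/-- Basic moves (moves of Type I). -/
def IsBasicMove {R C : ℕ} (z : Table R C) : Prop :=
  ∃ (i i' : Fin R) (j j' : Fin C), i ≠ i' ∧ j ≠ j' ∧
    z = e (i, j) + e (i', j') - e (i', j) - e (i, j')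

/-- A rectangle in the set of cells. -/
def IsRectangle {R C : ℕ} (S : Finset (Fin R × Fin C)) : Prop :=
  ∃ (a₁ a₂ : Fin R) (b₁ b₂ : Fin C), a₁ < a₂ ∧ b₁ < b₂ ∧
    S = Finset.univ.filter fun p => a₁ ≤ p.1 ∧ p.1 ≤ a₂ ∧ b₁ ≤ p.2 ∧ p.2 ≤ b₂

/-- The positive part `z⁺` of a move. -/
def posPart {R C : ℕ} (z : Table R C) : Table R C := fun p => max (z p) 0

/-- The negative part `z⁻` of a move. -/
def negPart {R C : ℕ} (z : Table R C) : Table R C := fun p => max (-z p) 0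

/-- The `(k,l)` block `I_{kl}` (cells are 1-indexed in the paper, hence the `+ 1`). -/
def block {R C : ℕ} (rr cc : ℕ → ℕ) (k l : ℕ) : Finset (Fin R × Fin C) :=
  Finset.univ.filter fun p =>
    rr k ≤ p.1.1 + 1 ∧ p.1.1 + 1 < rr (k+1) ∧ cc l ≤ p.2.1 + 1 ∧ p.2.1 + 1 < cc (l+1)

/-- `S = I_{11} ∪ I_{22} ∪ ⋯ ∪ I_{NN}` : the union of the diagonal blocks. -/
def Sdiag {R C : ℕ} (N : ℕ) (rr cc : ℕ → ℕ) : Finset (Fin R × Fin C) :=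
  (Finset.Icc 1 N).biUnion fun k => block rr cc k k

/-- Two cells lie in a common block `I_{kl}` with `1 ≤ k,l ≤ Nb`. -/
def SameBlock {R C : ℕ} (Nb : ℕ) (rr cc : ℕ → ℕ) (p q : Fin R × Fin C) : Prop :=
  ∃ k l, 1 ≤ k ∧ k ≤ Nb ∧ 1 ≤ l ∧ l ≤ Nb ∧
    p ∈ block (R := R) (C := C) rr cc k l ∧ q ∈ block rr cc k l

/-- Two row indices lie in a common row block `[r_k, r_{k+1})`. -/
def SameRowBlock {R : ℕ} (Nb : ℕ) (rr : ℕ → ℕ) (i i' : Fin R) : Prop :=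
  ∃ k, 1 ≤ k ∧ k ≤ Nb ∧ rr k ≤ i.1 + 1 ∧ i.1 + 1 < rr (k+1) ∧
    rr k ≤ i'.1 + 1 ∧ i'.1 + 1 < rr (k+1)

/-- Moves of Type II: a degree-3 square-free move whose six nonzero cells
lie outside `S` and in six pairwise distinct blocks.  `Nd` bounds the index of the
diagonal blocks of `S`, `Nb` bounds the block indices. -/
def IsTypeII {R C : ℕ} (Nd Nb : ℕ) (rr cc : ℕ → ℕ) (z : Table R C) : Prop :=
  ∃ (i₁ i₂ i₃ : Fin R) (j₁ j₂ j₃ : Fin C),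
    z = e (i₁,j₂) + e (i₂,j₃) + e (i₃,j₁) - e (i₁,j₃) - e (i₂,j₁) - e (i₃,j₂) ∧
    (∀ p ∈ ([(i₁,j₂),(i₂,j₃),(i₃,j₁),(i₁,j₃),(i₂,j₁),(i₃,j₂)] : List (Fin R × Fin C)),
      p ∉ Sdiag Nd rr cc) ∧
    List.Pairwise (fun p q => ¬ SameBlock Nb rr cc p q)
      [(i₁,j₂),(i₂,j₃),(i₃,j₁),(i₁,j₃),(i₂,j₁),(i₃,j₂)]

/-- Moves of Type III. -/
def IsTypeIII {R C : ℕ} (Nd Nb : ℕ) (rr cc : ℕ → ℕ) (z : Table R C) : Prop :=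
  ∃ (i₁ i₂ i₃ : Fin R) (j₁ j₂ j₃ : Fin C),
    z = e (i₁,j₁) + e (i₂,j₃) + e (i₃,j₂) - e (i₁,j₃) - e (i₂,j₂) - e (i₃,j₁) ∧
    (∃ k l, 1 ≤ k ∧ k ≤ Nd ∧ 1 ≤ l ∧ l ≤ Nd ∧ k ≠ l ∧
      (i₁,j₁) ∈ block (R := R) (C := C) rr cc k k ∧ (i₂,j₂) ∈ block rr cc l l) ∧
    (∀ p ∈ ([(i₂,j₃),(i₃,j₂),(i₁,j₃),(i₃,j₁)] : List (Fin R × Fin C)),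
      p ∉ Sdiag Nd rr cc) ∧
    List.Pairwise (fun p q => ¬ SameBlock Nb rr cc p q) [(i₂,j₃),(i₃,j₂),(i₁,j₃),(i₃,j₁)]

/-- Moves of Type IV (row version). -/
def IsTypeIVrow {R C : ℕ} (Nd Nb : ℕ) (rr cc : ℕ → ℕ) (z : Table R C) : Prop :=
  ∃ (i₁ i₂ i₃ i₄ : Fin R) (j₁ j₂ j₃ j₄ : Fin C),
    z = e (i₁,j₁) + e (i₂,j₂) + e (i₃,j₃) + e (i₄,j₄)
        - e (i₁,j₃) - e (i₂,j₄) - e (i₃,j₂) - e (i₄,j₁) ∧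
    (∃ k l, 1 ≤ k ∧ k ≤ Nd ∧ 1 ≤ l ∧ l ≤ Nd ∧ k ≠ l ∧
      (i₁,j₁) ∈ block (R := R) (C := C) rr cc k k ∧ (i₃,j₂) ∈ block rr cc l l) ∧
    (∀ p ∈ ([(i₂,j₂),(i₃,j₃),(i₄,j₄),(i₁,j₃),(i₂,j₄),(i₄,j₁)] : List (Fin R × Fin C)),
      p ∉ Sdiag Nd rr cc) ∧
    SameRowBlock Nb rr i₁ i₂ ∧ SameRowBlock Nb rr i₃ i₄

/-- Moves of Type IV, including the transposes of the row-version moves. -/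
def IsTypeIV {R C : ℕ} (Nd Nb : ℕ) (rr cc : ℕ → ℕ) (z : Table R C) : Prop :=
  IsTypeIVrow Nd Nb rr cc z ∨
    IsTypeIVrow (R := C) (C := R) Nd Nb cc rr (fun p => z (p.2, p.1))

/-- basic table -/
def bas {R C : ℕ} (i i' : Fin R) (j j' : Fin C) : Table R C :=
  e (i, j) + e (i', j') - e (i', j) - e (i, j')

lemma sum_e_row {R C : ℕ} (a : Fin R × Fin C) (i : Fin R) :
    ∑ j, e a (i, j) = if i = a.1 then 1 else 0 := by
  obtain ⟨a, b⟩ := a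
  by_cases h : i = a <;> simp [e, h]

lemma sum_e_col {R C : ℕ} (a : Fin R × Fin C) (j : Fin C) :
    ∑ i, e a (i, j) = if j = a.2 then 1 else 0 := by
  obtain ⟨a, b⟩ := a
  by_cases h : j = b <;> simp [e, h]

lemma sum_e_out {R C : ℕ} (a : Fin R × Fin C) (T : Finset (Fin R × Fin C)) (h : a ∉ T) :
    ∑ p ∈ T, e a p = 0 := by
  simp [e, h]

lemma isMove_bas {R C N : ℕ} (S : Fin N → Finset (Fin R × Fin C)) (i i' : Fin R)
    (j j' : Fin C) (h : ∀ n, (i, j) ∉ S n ∧ (i', j') ∉ S n ∧ (i', j) ∉ S n ∧ (i, j') ∉ S n) :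
    IsMove S (bas i i' j j') := by
  unfold IsMove configMap bas
  refine Prod.ext ?_ (Prod.ext ?_ ?_)
  · funext k
    simp only [Pi.add_apply, Pi.sub_apply, Finset.sum_add_distrib, Finset.sum_sub_distrib,
      sum_e_row]
    simp
  · funext k
    simp only [Pi.add_apply, Pi.sub_apply, Finset.sum_add_distrib, Finset.sum_sub_distrib,
      sum_e_col]
    simp
  · funext n
    obtain ⟨h1, h2, h3, h4⟩ := h n
    simp only [Pi.add_apply, Pi.sub_apply, Finset.sum_add_distrib, Finset.sum_sub_distrib,
      sum_e_out _ _ h1, sum_e_out _ _ h2, sum_e_out _ _ h3, sum_e_out _ _ h4]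
    simp

lemma configMap_add {R C N : ℕ} (S : Fin N → Finset (Fin R × Fin C)) (x z : Table R C) :
    configMap S (x + z) = configMap S x + configMap S z := by
  unfold configMap
  refine Prod.ext ?_ (Prod.ext ?_ ?_) <;> funext k <;> simp [Finset.sum_add_distrib]

lemma fiber_add_bas {R C N : ℕ} (S : Fin N → Finset (Fin R × Fin C)) (i i' : Fin R)
    (j j' : Fin C) (t) (x : Table R C) (hx : x ∈ Fiber S t) (hm : IsMove S (bas i i' j j'))
    (hi : i ≠ i') (hj : j ≠ j') (h1 : 0 < x (i', j)) (h2 : 0 < x (i, j')) :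
    x + bas i i' j j' ∈ Fiber S t := by
  refine ⟨fun p => ?_, ?_⟩
  · have := hx.1 p
    simp only [Pi.add_apply, Pi.sub_apply, bas, e]
    by_cases q1 : p = (i', j)
    · subst q1
      split_ifs <;> simp_all <;> omega
    · by_cases q2 : p = (i, j')
      · subst q2
        split_ifs <;> simp_all <;> omega
      · rw [if_neg q1, if_neg q2]
        split_ifs <;> omega
  · rw [configMap_add, hx.2, hm, add_zero]

lemma l1_neg {R C : ℕ} (z : Table R C) : l1 (-z) = l1 z := by
  simp [l1]

lemma l1_bas {R C : ℕ} (z : Table R C) (i i' : Fin R) (j j' : Fin C)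
    (hi : i ≠ i') (hj : j ≠ j') (h0 : z (i, j) < 0) (h1 : 0 < z (i', j)) (h2 : 0 < z (i, j')) :
    l1 (z + bas i i' j j') < l1 z := by
  have key : ∀ p, |(z + bas i i' j j') p| ≤
      |z p| + (e (i', j') p - e (i, j) p - e (i', j) p - e (i, j') p) := by
    intro p
    simp only [Pi.add_apply, Pi.sub_apply, bas, e]
    by_cases q0 : p = (i, j)
    · subst q0
      simp [hi, hj, abs_of_neg h0]
      rw [abs_of_nonpos (by omega)]; omega
    by_cases q1 : p = (i', j)
    · subst q1
      simp [hi.symm, hj, abs_of_pos h1]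
      rw [abs_of_nonneg (by omega)]
      omega
    by_cases q2 : p = (i, j')
    · subst q2
      simp [hi, hj.symm, abs_of_pos h2]
      rw [abs_of_nonneg (by omega)]
      omega
    rw [if_neg q0, if_neg q1, if_neg q2]
    split_ifs
    · simpa using abs_add_le (z p) 1
    · simp
  have hs : ∀ a : Fin R × Fin C, ∑ p, e a p = 1 := by
    intro a; simp [e]
  unfold l1
  calc _ ≤ ∑ p, (|z p| + (e (i', j') p - e (i, j) p - e (i', j) p - e (i, j') p)) :=
        Finset.sum_le_sum fun p _ => key p
    _ = ∑ p, |z p| - 2 := by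
        simp only [Finset.sum_add_distrib, Finset.sum_sub_distrib, hs]; ring
    _ < _ := by omega

lemma exists_neg_of_sum {n : ℕ} (f : Fin n → ℤ) (h : ∑ i, f i = 0) (i : Fin n) (hi : 0 < f i) :
    ∃ k, f k < 0 := by
  by_contra! hc
  have := (Finset.sum_eq_zero_iff_of_nonneg (fun k _ => hc k)).1 h i (Finset.mem_univ i)
  omega

lemma exists_pos_of_sum {n : ℕ} (f : Fin n → ℤ) (h : ∑ i, f i = 0) (i : Fin n) (hi : f i < 0) :
    ∃ k, 0 < f k := by
  obtain ⟨k, hk⟩ := exists_neg_of_sum (fun k => - f k) (by simp [h]) i (by simpa using hi)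
  exact ⟨k, by simpa using hk⟩

lemma core {R C : ℕ} (P : Fin R → Prop) (Q : Fin C → Prop) (z : Table R C) (hz : z ≠ 0)
    (hr : ∀ i, ∑ j, z (i, j) = 0) (hc : ∀ j, ∑ i, z (i, j) = 0)
    (hv : ∀ i j, P i → Q j → z (i, j) = 0) :
    ∃ i i' j j', ((¬ P i ∧ ¬ P i') ∨ (¬ Q j ∧ ¬ Q j')) ∧
      ((z (i, j) < 0 ∧ 0 < z (i', j) ∧ 0 < z (i, j')) ∨
       (0 < z (i, j) ∧ z (i', j) < 0 ∧ z (i, j') < 0)) := by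
  have hrow : ∀ i j, z (i, j) ≠ 0 → ∃ j₁ j₂, 0 < z (i, j₁) ∧ z (i, j₂) < 0 := by
    intro i j h
    rcases lt_or_gt_of_ne h with h | h
    · obtain ⟨k, hk⟩ := exists_pos_of_sum (fun j => z (i, j)) (hr i) j h
      exact ⟨k, j, hk, h⟩
    · obtain ⟨k, hk⟩ := exists_neg_of_sum (fun j => z (i, j)) (hr i) j h
      exact ⟨j, k, h, hk⟩
  have main : ∀ i j₁ j₂, 0 < z (i, j₁) → z (i, j₂) < 0 → (P i → ¬ Q j₁ ∧ ¬ Q j₂) := by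
    intro i j₁ j₂ h1 h2 hP
    refine ⟨fun hQ => ?_, fun hQ => ?_⟩
    · have := hv _ _ hP hQ; omega
    · have := hv _ _ hP hQ; omega
  obtain ⟨⟨i, j⟩, hij⟩ := Function.ne_iff.1 hz
  obtain ⟨j₁, j₂, h1, h2⟩ := hrow i j hij
  obtain ⟨i₁, g1⟩ := exists_neg_of_sum (fun i => z (i, j₁)) (hc j₁) i h1
  obtain ⟨i₂, g2⟩ := exists_pos_of_sum (fun i => z (i, j₂)) (hc j₂) i h2
  have m := main i j₁ j₂ h1 h2
  by_cases hQ : ¬ Q j₁ ∧ ¬ Q j₂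
  · exact ⟨i, i₁, j₁, j₂, Or.inr hQ, Or.inr ⟨h1, g1, h2⟩⟩
  have hP : ¬ P i := fun h => hQ (m h)
  by_cases hQ1 : Q j₁
  · have : ¬ P i₁ := fun h => by have := hv _ _ h hQ1; simp_all
    exact ⟨i, i₁, j₁, j₂, Or.inl ⟨hP, this⟩, Or.inr ⟨h1, g1, h2⟩⟩
  · have hQ2 : Q j₂ := by tauto
    have : ¬ P i₂ := fun h => by have := hv _ _ h hQ2; simp_all
    exact ⟨i, i₂, j₂, j₁, Or.inl ⟨hP, this⟩, Or.inl ⟨h2, g2, h1⟩⟩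

/-- in the change point model, if `z = x − y` vanishes on `S_N`,
then `‖z‖₁` can be reduced by the basic moves in `M_{S_1,…,S_N}`. -/
theorem changePoint_reduce_of_vanish_SN (R C N : ℕ) (hN : 1 ≤ N)
    (S : ℕ → Finset (Fin R × Fin C))
    (hrect : ∀ n, 1 ≤ n → n ≤ N → IsRectangle (S n))
    (hchain : ∀ n m, 1 ≤ n → n < m → m ≤ N → S n ⊂ S m)
    (htop : S N ⊂ Finset.univ)
    (t : (Fin R → ℤ) × (Fin C → ℤ) × (Fin N → ℤ))
    (x y : Table R C)
    (hx : x ∈ Fiber (fun n : Fin N => S (n.1 + 1)) t)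
    (hy : y ∈ Fiber (fun n : Fin N => S (n.1 + 1)) t)
    (hxy : x ≠ y)
    (hlast : ∀ p ∈ S N, x p - y p = 0) :
    CanReduce (Fiber (fun n : Fin N => S (n.1 + 1)) t)
      {z | IsBasicMove z ∧ IsMove (fun n : Fin N => S (n.1 + 1)) z} x y := by
  obtain ⟨a₁, a₂, b₁, b₂, -, -, hS⟩ := hrect N hN le_rfl
  have hsub : ∀ n : Fin N, S (n.1 + 1) ⊆ S N := by
    intro n
    rcases Nat.lt_or_ge (n.1 + 1) N with h | h
    · exact (hchain _ _ (by omega) h le_rfl).1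
    · have : n.1 + 1 = N := by omega
      rw [this]
  have hz : x - y ≠ 0 := sub_ne_zero.2 hxy
  have hcm := hx.2.trans hy.2.symm
  have hr : ∀ i, ∑ j, (x - y) (i, j) = 0 := by
    intro i
    have := congrFun (congrArg Prod.fst hcm) i
    simpa [configMap, sub_eq_zero] using this
  have hc : ∀ j, ∑ i, (x - y) (i, j) = 0 := by
    intro j
    have := congrFun (congrArg (fun q => q.2.1) hcm) j
    simpa [configMap, sub_eq_zero] using this
  obtain ⟨i, i', j, j', hPQ, hsgn⟩ := core (fun i => a₁ ≤ i ∧ i ≤ a₂) (fun j => b₁ ≤ j ∧ j ≤ b₂)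
    (x - y) hz hr hc (fun i j hi hj => hlast (i, j) (by
      rw [hS]; simp only [Finset.mem_filter, Finset.mem_univ, true_and]
      exact ⟨hi.1, hi.2, hj.1, hj.2⟩))
  have hmem : ∀ k l, (k, l) ∈ S N → (a₁ ≤ k ∧ k ≤ a₂) ∧ (b₁ ≤ l ∧ l ≤ b₂) := by
    intro k l h
    rw [hS] at h
    simp only [Finset.mem_filter, Finset.mem_univ, true_and] at h
    exact ⟨⟨h.1, h.2.1⟩, h.2.2⟩
  have h1 : (i, j) ∉ S N := fun h => by have := hmem _ _ h; tauto
  have h2 : (i', j') ∉ S N := fun h => by have := hmem _ _ h; tauto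
  have h3 : (i', j) ∉ S N := fun h => by have := hmem _ _ h; tauto
  have h4 : (i, j') ∉ S N := fun h => by have := hmem _ _ h; tauto
  have hi : i ≠ i' := by rintro rfl; omega
  have hj : j ≠ j' := by rintro rfl; omega
  have hx0 := hx.1
  have hy0 := hy.1
  have mv : IsMove (fun n : Fin N => S (n.1 + 1)) (bas i i' j j') :=
    isMove_bas _ _ _ _ _ fun n => ⟨fun h => h1 (hsub n h), fun h => h2 (hsub n h),
      fun h => h3 (hsub n h), fun h => h4 (hsub n h)⟩
  have mv' : IsMove (fun n : Fin N => S (n.1 + 1)) (bas i i' j' j) :=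
    isMove_bas _ _ _ _ _ fun n => ⟨fun h => h4 (hsub n h), fun h => h3 (hsub n h),
      fun h => h2 (hsub n h), fun h => h1 (hsub n h)⟩
  have hneg : bas i i' j' j = - bas i i' j j' := by
    unfold bas; abel
  rcases hsgn with ⟨s0, s1, s2⟩ | ⟨s0, s1, s2⟩
  · refine ⟨1, 0, by norm_num, fun _ => bas i i' j j', fun _ => 0, fun _ =>
      ⟨⟨i, i', j, j', hi, hj, rfl⟩, mv⟩, fun s => s.elim0, fun u => ?_, fun u => u.elim0, ?_⟩
    · have hu : Finset.Iic u = {0} := by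
        ext v; simp [Subsingleton.elim v 0, Subsingleton.elim u 0]
      rw [hu, Finset.sum_singleton]
      simp only [Pi.sub_apply] at s1 s2
      exact fiber_add_bas _ _ _ _ _ _ _ hx mv hi hj
        (by have := hy0 (i', j); omega) (by have := hy0 (i, j'); omega)
    · simpa using l1_bas _ _ _ _ _ hi hj s0 s1 s2
  · refine ⟨0, 1, by norm_num, fun _ => 0, fun _ => bas i i' j' j, fun s => s.elim0, fun _ =>
      ⟨⟨i, i', j', j, hi, hj.symm, rfl⟩, mv'⟩, fun u => u.elim0, fun u => ?_, ?_⟩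
    · have hu : Finset.Iic u = {0} := by
        ext v; simp [Subsingleton.elim v 0, Subsingleton.elim u 0]
      rw [hu, Finset.sum_singleton, hneg, sub_neg_eq_add]
      simp only [Pi.sub_apply] at s1 s2
      exact fiber_add_bas _ _ _ _ _ _ _ hy mv hi hj
        (by have := hx0 (i', j); omega) (by have := hx0 (i, j'); omega)
    · have := l1_bas (-(x - y)) i i' j j' hi hj (by simpa using s0) (by simpa using s1)
        (by simpa using s2)
      rw [l1_neg, ← l1_neg (_ + _)] at this
      have e1 : -(-(x - y) + bas i i' j j') = x - y + bas i i' j' j := by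
        rw [hneg]; abel
      rw [e1] at this
      simpa using this

end Paper
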